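/- Suppose χ : R → Bool is a checkerboard function with χ r₀ = false and such that at every crossing c, χ (ρ₁ c) ≠ χ (ρ₂ c) and χ (ρ₃ c) ≠ χ (ρ₄ c), and fix a region r₁ : R with χ r₁ = true (a bounded region adjacent to the unbounded one). Then every Dehn n-coloring g decomposes uniquely as the sum of a trivial Dehn n-coloring (taking value a on {χ = true} and 0 on {χ = false}, for a unique a : ZMod n) and a Dehn n-coloring g₀ with g₀ r₁ = 0; that is, based Dehn n-colorings are uniquely represented by Dehn n-colorings assigning 0 to both r₀ and r₁. -/

import Mathlib

/-- A Dehn n-coloring of the abstract region data. -/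
def IsDehnColoring {R C : Type} (r₀ : R) (ρ₁ ρ₂ ρ₃ ρ₄ : C → R) {n : ℕ}
    (g : R → ZMod n) : Prop :=
  g r₀ = 0 ∧ ∀ c : C, g (ρ₁ c) + g (ρ₂ c) = g (ρ₃ c) + g (ρ₄ c)

theorem IsDehnColoring.sub {R C : Type} {r₀ : R} {ρ₁ ρ₂ ρ₃ ρ₄ : C → R} {n : ℕ}
    {g h : R → ZMod n} (hg : IsDehnColoring r₀ ρ₁ ρ₂ ρ₃ ρ₄ g)
    (hh : IsDehnColoring r₀ ρ₁ ρ₂ ρ₃ ρ₄ h) : IsDehnColoring r₀ ρ₁ ρ₂ ρ₃ ρ₄ (g - h) := by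
  refine ⟨by simp [hg.1, hh.1], fun c => ?_⟩
  simp only [Pi.sub_apply]
  linear_combination hg.2 c - hh.2 c

theorem isDehnColoring_checkerboard {R C : Type} {r₀ : R} {ρ₁ ρ₂ ρ₃ ρ₄ : C → R} {n : ℕ}
    {χ : R → Bool} (hχ₀ : χ r₀ = false)
    (hχ : ∀ c : C, χ (ρ₁ c) ≠ χ (ρ₂ c) ∧ χ (ρ₃ c) ≠ χ (ρ₄ c)) (a : ZMod n) :
    IsDehnColoring r₀ ρ₁ ρ₂ ρ₃ ρ₄ (fun r => if χ r then a else 0) := by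
  have ite_add_ite : ∀ {x y : Bool}, x ≠ y →
      (if x then a else 0) + (if y then a else 0) = a := by
    intro x y hxy
    cases x <;> cases y <;> simp_all
  exact ⟨by simp [hχ₀], fun c => (ite_add_ite (hχ c).1).trans (ite_add_ite (hχ c).2).symm⟩

/-- Given a checkerboard function `χ` (with `χ r₀ = false`, opposite
values on paired regions at every crossing) and a region `r₁` with `χ r₁ = true`,
every Dehn n-coloring decomposes uniquely as the sum of a trivial checkerboard Dehn
n-coloring and a Dehn n-coloring vanishing at `r₁`. -/
theorem dehn_coloring_based_decomposition (R C : Type) (r₀ : R) (ρ₁ ρ₂ ρ₃ ρ₄ : C → R)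
    (n : ℕ) (χ : R → Bool) (hχ₀ : χ r₀ = false)
    (hχ : ∀ c : C, χ (ρ₁ c) ≠ χ (ρ₂ c) ∧ χ (ρ₃ c) ≠ χ (ρ₄ c))
    (r₁ : R) (hr₁ : χ r₁ = true)
    (g : R → ZMod n) (hg : IsDehnColoring r₀ ρ₁ ρ₂ ρ₃ ρ₄ g) :
    ∃! p : ZMod n × (R → ZMod n),
      IsDehnColoring r₀ ρ₁ ρ₂ ρ₃ ρ₄ p.2 ∧ p.2 r₁ = 0 ∧
        g = (fun r => if χ r then p.1 else 0) + p.2 := by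
  refine ⟨(g r₁, g - fun r => if χ r then g r₁ else 0),
    ⟨hg.sub (isDehnColoring_checkerboard hχ₀ hχ (g r₁)), by simp [hr₁],
      (add_sub_cancel _ _).symm⟩, ?_⟩
  rintro ⟨a, g₀⟩ ⟨-, h₁, hdecomp⟩
  dsimp only at h₁ hdecomp
  obtain rfl : g r₁ = a := by simpa [hr₁, h₁] using congrFun hdecomp r₁
  exact Prod.ext rfl (eq_sub_of_add_eq' hdecomp.symm)
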